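/- For every element P ∈ C with n(P) = 1 there exist X, Y ∈ F⁷ such that (0,X)·(0,Y) = P; that is, every norm-one element of the octonion algebra C is a product of two purely imaginary octonions. -/

import Mathlib

open Matrix

noncomputable section

/-- `F⁷`, identified with `F × F³ × F³`, elements written `(s, u, v)`. -/
abbrev V7 (F : Type) := F × (Fin 3 → F) × (Fin 3 → F)

variable {F : Type} [Field F]

/-- The quadratic form `n(s,u,v) = -s² - 4 uᵀv` on `F⁷`. -/
def nq (X : V7 F) : F := -X.1 ^ 2 - 4 * (X.2.1 ⬝ᵥ X.2.2)

/-- The symmetric bilinear form associated to `n` by polarization. -/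
def nb (X Y : V7 F) : F := (nq (X + Y) - nq X - nq Y) / 2

/-- The bilinear product `×` on `F⁷`. -/
def cr (X Y : V7 F) : V7 F :=
  (2 * (X.2.1 ⬝ᵥ Y.2.2) - 2 * (X.2.2 ⬝ᵥ Y.2.1),
   X.1 • Y.2.1 - Y.1 • X.2.1 - (2 : F) • (crossProduct X.2.2 Y.2.2),
   -(X.1 • Y.2.2) + Y.1 • X.2.2 + (2 : F) • (crossProduct X.2.1 Y.2.1))

/-- The octonion algebra `C = F × F⁷`. -/
abbrev Oct (F : Type) := F × V7 F

/-- The product on `C`: `(α,X)·(β,Y) = (αβ − n(X,Y), α·Y + β·X + X × Y)`. -/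
def omul (P Q : Oct F) : Oct F :=
  (P.1 * Q.1 - nb P.2 Q.2, P.1 • Q.2 + Q.1 • P.2 + cr P.2 Q.2)

/-- The extended quadratic form on `C`: `n(α,X) = α² + n(X)`. -/
def onq (P : Oct F) : F := P.1 ^ 2 + nq P.2

/-- Statement 18 for a given field `F`: every norm-one element of `C` is a product
of two purely imaginary octonions. -/
def Stmt18 (F : Type) [Field F] : Prop :=
  ∀ P : Oct F, onq P = 1 →
    ∃ X Y : V7 F, omul ((0, X) : Oct F) ((0, Y) : Oct F) = P

theorem nb_eq (h2 : (2 : F) ≠ 0) (X Y : V7 F) :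
    nb X Y = -(X.1 * Y.1) - 2 * (X.2.1 ⬝ᵥ Y.2.2 + X.2.2 ⬝ᵥ Y.2.1) := by
  rw [nb, div_eq_iff h2]
  simp only [nq, dotProduct, Fin.sum_univ_three, Prod.fst_add, Prod.snd_add, Pi.add_apply]
  ring

theorem cr_cr (h2 : (2 : F) ≠ 0) (X Z : V7 F) :
    cr X (cr X Z) = nb X Z • X - nq X • Z := by
  rw [nb_eq h2]
  obtain ⟨s, u, v⟩ := X
  obtain ⟨t, x, y⟩ := Z
  refine Prod.ext ?_ (Prod.ext ?_ ?_)
  · simp [cr, nq, cross_apply, vecHead, vecTail, dotProduct, Fin.sum_univ_three]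
    ring
  · ext i
    fin_cases i <;>
      simp [cr, nq, cross_apply, vecHead, vecTail, dotProduct, Fin.sum_univ_three] <;> ring
  · ext i
    fin_cases i <;>
      simp [cr, nq, cross_apply, vecHead, vecTail, dotProduct, Fin.sum_univ_three] <;> ring

theorem nb_cr_self (h2 : (2 : F) ≠ 0) (X Z : V7 F) : nb X (cr X Z) = 0 := by
  rw [nb_eq h2]
  simp [cr, cross_apply, vecHead, vecTail, dotProduct, Fin.sum_univ_three]
  ring

theorem cr_self (X : V7 F) : cr X X = 0 := by
  simp [cr, cross_self, dotProduct_comm]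

theorem cr_smul_add_smul (X Y Z : V7 F) (a b : F) :
    cr X (a • Y + b • Z) = a • cr X Y + b • cr X Z := by
  simp only [cr, Prod.fst_add, Prod.snd_add, Prod.smul_fst, Prod.smul_snd, dotProduct_add,
    dotProduct_smul, map_add, map_smul, smul_add, Prod.ext_iff, smul_eq_mul]
  refine ⟨?_, ?_, ?_⟩
  · ring
  · module
  · module

theorem nb_smul_add_smul (h2 : (2 : F) ≠ 0) (X Y Z : V7 F) (a b : F) :
    nb X (a • Y + b • Z) = a * nb X Y + b * nb X Z := by
  simp only [nb_eq h2, Prod.fst_add, Prod.snd_add, Prod.smul_fst, Prod.smul_snd, dotProduct_add,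
    dotProduct_smul, smul_eq_mul]
  ring

theorem nb_self (h2 : (2 : F) ≠ 0) (X : V7 F) : nb X X = nq X := by
  rw [nb_eq h2, nq, dotProduct_comm X.2.2]
  ring

/-- Every vector is orthogonal to some anisotropic vector. -/
theorem exists_nb_eq_zero_nq_ne_zero (h2 : (2 : F) ≠ 0) (Z : V7 F) :
    ∃ X : V7 F, nb X Z = 0 ∧ nq X ≠ 0 := by
  obtain ⟨s, u, v⟩ := Z
  have h4 : (4 : F) ≠ 0 := by
    have : (4 : F) = 2 * 2 := by norm_num
    rw [this]
    exact mul_ne_zero h2 h2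
  simp only [nb_eq h2, nq]
  by_cases hv : v 0 = 0
  · by_cases hu : u 0 = 0
    · refine ⟨(0, ![1, 0, 0], ![1, 0, 0]), ?_, ?_⟩ <;>
        simp [dotProduct, Fin.sum_univ_three, hu, hv, h4]
    · refine ⟨(0, ![0, 1, 0], ![-(u 1 + v 1) / u 0, 1, 0]), ?_, ?_⟩
      · simp [dotProduct, Fin.sum_univ_three]
        field_simp
        simp
      · simp [dotProduct, Fin.sum_univ_three, h4]
  · refine ⟨(0, ![-(u 1 + v 1) / v 0, 1, 0], ![0, 1, 0]), ?_, ?_⟩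
    · simp [dotProduct, Fin.sum_univ_three]
      field_simp
      simp
    · simp [dotProduct, Fin.sum_univ_three, h4]

/-- In characteristic other than two, every octonion is a product of two imaginary ones. -/
theorem exists_omul_imaginary_eq (h2 : (2 : F) ≠ 0) (P : Oct F) :
    ∃ X Y : V7 F, omul ((0, X) : Oct F) ((0, Y) : Oct F) = P := by
  obtain ⟨α, Z⟩ := P
  obtain ⟨X, hXZ, hX⟩ := exists_nb_eq_zero_nq_ne_zero h2 Z
  refine ⟨X, (-(nq X)⁻¹ * α) • X + (-(nq X)⁻¹) • cr X Z, ?_⟩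
  refine Prod.ext ?_ ?_
  · simp only [omul, nb_smul_add_smul h2, nb_self h2, nb_cr_self h2]
    field_simp
    ring
  · simp only [omul, zero_smul, zero_add]
    rw [cr_smul_add_smul, cr_self, cr_cr h2, hXZ, zero_smul, smul_zero, zero_add, zero_sub,
      smul_neg, neg_smul, neg_neg, inv_smul_smul₀ hX]

/-- For `F = ℝ` and `F = ℂ`: for every `P ∈ C` with `n(P) = 1` there exist
`X, Y ∈ F⁷` with `(0,X)·(0,Y) = P`; every norm-one octonion is a product of two
purely imaginary octonions. -/
theorem stmt18 : Stmt18 ℝ ∧ Stmt18 ℂ := by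
  exact ⟨fun P _ ↦ exists_omul_imaginary_eq two_ne_zero P,
    fun P _ ↦ exists_omul_imaginary_eq two_ne_zero P⟩
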